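/- If f : I → (0,∞) is harmonically convex on I ⊆ (0,∞) and u, v ∈ I with u < v, then f(2uv/(u+v)) ≤ (uv/(v-u)) ∫_u^v f(x)/x² dx ≤ (f(u)+f(v))/2. -/

import Mathlib

open MeasureTheory in
/-- The Hermite–Hadamard inequality for convex functions on a compact interval. -/
theorem ConvexOn.hermite_hadamard {g : ℝ → ℝ} {p q : ℝ} (hpq : p < q)
    (hg : ConvexOn ℝ (Set.Icc p q) g) (hint : IntervalIntegrable g volume p q) :
    g ((p + q) / 2) ≤ (q - p)⁻¹ * ∫ t in p..q, g t ∧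
      (q - p)⁻¹ * ∫ t in p..q, g t ≤ (g p + g q) / 2 := by
  have h_refl : IntervalIntegrable (fun t ↦ g (p + q - t)) volume p q := by
    simpa using (hint.comp_sub_left (p + q)).symm
  have h_sum : ∫ t in p..q, (g t + g (p + q - t)) = 2 * ∫ t in p..q, g t := by
    rw [intervalIntegral.integral_add hint h_refl, intervalIntegral.integral_comp_sub_left]
    simp only [add_sub_cancel_right, add_sub_cancel_left]
    ring
  have h_pos : 0 < q - p := sub_pos.2 hpq
  have h_lower : (q - p) * (2 * g ((p + q) / 2)) ≤ 2 * ∫ t in p..q, g t := by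
    rw [← h_sum, ← smul_eq_mul, ← intervalIntegral.integral_const]
    refine intervalIntegral.integral_mono_on hpq.le intervalIntegrable_const
      (hint.add h_refl) fun t ht ↦ ?_
    have h_mem : p + q - t ∈ Set.Icc p q := ⟨by linarith [ht.2], by linarith [ht.1]⟩
    have h := hg.2 ht h_mem (show (0 : ℝ) ≤ 1 / 2 by norm_num)
      (show (0 : ℝ) ≤ 1 / 2 by norm_num) (by norm_num)
    simp only [smul_eq_mul] at h
    rw [show 1 / 2 * t + 1 / 2 * (p + q - t) = (p + q) / 2 by ring] at h
    linarith
  have h_upper : 2 * ∫ t in p..q, g t ≤ (q - p) * (g p + g q) := by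
    rw [← h_sum, ← smul_eq_mul, ← intervalIntegral.integral_const]
    refine intervalIntegral.integral_mono_on hpq.le (hint.add h_refl)
      intervalIntegrable_const fun t ht ↦ ?_
    have hp : p ∈ Set.Icc p q := Set.left_mem_Icc.2 hpq.le
    have hq : q ∈ Set.Icc p q := Set.right_mem_Icc.2 hpq.le
    have ha : 0 ≤ (q - t) / (q - p) := div_nonneg (by linarith [ht.2]) h_pos.le
    have hb : 0 ≤ (t - p) / (q - p) := div_nonneg (by linarith [ht.1]) h_pos.le
    have hab : (q - t) / (q - p) + (t - p) / (q - p) = 1 := by field_simp; ring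
    have h₁ := hg.2 hp hq ha hb hab
    have h₂ := hg.2 hq hp ha hb hab
    simp only [smul_eq_mul] at h₁ h₂
    rw [show (q - t) / (q - p) * p + (t - p) / (q - p) * q = t by field_simp; ring] at h₁
    rw [show (q - t) / (q - p) * q + (t - p) / (q - p) * p = p + q - t by
      field_simp; ring] at h₂
    linear_combination h₁ + h₂ + (g p + g q) * hab
  rw [inv_mul_eq_div, le_div_iff₀ h_pos, div_le_iff₀ h_pos]
  constructor <;> linarith

theorem inv_image_Icc_of_pos {u v : ℝ} (hu : 0 < u) (huv : u ≤ v) :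
    (fun x : ℝ ↦ x⁻¹) '' Set.Icc u v = Set.Icc v⁻¹ u⁻¹ := by
  have hv := hu.trans_le huv
  ext t
  constructor
  · rintro ⟨x, ⟨h₁, h₂⟩, rfl⟩
    exact ⟨inv_anti₀ (hu.trans_le h₁) h₂, inv_anti₀ hu h₁⟩
  · rintro ⟨h₁, h₂⟩
    have ht : 0 < t := (inv_pos.2 hv).trans_le h₁
    exact ⟨t⁻¹, ⟨(le_inv_comm₀ ht hu).1 h₂, (inv_le_comm₀ hv ht).1 h₁⟩, inv_inv t⟩

open MeasureTheory in
/-- The change of variables `t = x⁻¹` on a compact interval of positive reals. -/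
theorem intervalIntegral_comp_inv {f : ℝ → ℝ} {u v : ℝ} (hu : 0 < u) (huv : u ≤ v)
    (hint : IntervalIntegrable f volume u v) :
    IntervalIntegrable (fun t ↦ f t⁻¹) volume v⁻¹ u⁻¹ ∧
      ∫ t in v⁻¹..u⁻¹, f t⁻¹ = ∫ x in u..v, f x / x ^ 2 := by
  have h_inv : v⁻¹ ≤ u⁻¹ := inv_anti₀ hu huv
  have h_pos : ∀ x ∈ Set.Icc u v, x ≠ 0 := fun x hx ↦ (hu.trans_le hx.1).ne'
  have h_deriv : ∀ x ∈ Set.Icc u v,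
      HasDerivWithinAt (fun x : ℝ ↦ x⁻¹) (-(x ^ 2)⁻¹) (Set.Icc u v) x :=
    fun x hx ↦ (hasDerivAt_inv (h_pos x hx)).hasDerivWithinAt
  have h_inj : Set.InjOn (fun x : ℝ ↦ x⁻¹) (Set.Icc u v) := inv_injective.injOn
  have h_fun : ∀ x : ℝ, |-(x ^ 2)⁻¹| • f x⁻¹⁻¹ = f x / x ^ 2 := fun x ↦ by
    rw [abs_neg, abs_of_nonneg (by positivity), inv_inv, smul_eq_mul, inv_mul_eq_div]
  have h_weight : IntegrableOn (fun x ↦ f x / x ^ 2) (Set.Icc u v) := by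
    have hf : IntegrableOn f (Set.Icc u v) :=
      (intervalIntegrable_iff_integrableOn_Icc_of_le huv).1 hint
    simp only [div_eq_mul_inv]
    refine hf.mul_continuousOn (ContinuousOn.inv₀ (by fun_prop) fun x hx ↦ ?_) isCompact_Icc
    exact pow_ne_zero 2 (h_pos x hx)
  rw [intervalIntegrable_iff_integrableOn_Icc_of_le h_inv,
    intervalIntegral.integral_of_le h_inv, intervalIntegral.integral_of_le huv,
    ← integral_Icc_eq_integral_Ioc, ← integral_Icc_eq_integral_Ioc,
    ← inv_image_Icc_of_pos hu huv,
    integrableOn_image_iff_integrableOn_abs_deriv_smul measurableSet_Icc h_deriv h_inj,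
    integral_image_eq_integral_abs_deriv_smul measurableSet_Icc h_deriv h_inj]
  simp only [h_fun]
  exact ⟨h_weight, trivial⟩

theorem hermite_hadamard_harmonically_convex (I : Set ℝ) (hI : I ⊆ Set.Ioi (0:ℝ))
    (hIcc : Set.OrdConnected I) (f : ℝ → ℝ) (hfpos : ∀ x ∈ I, 0 < f x)
    (hf : ∀ a ∈ I, ∀ b ∈ I, ∀ l ∈ Set.Icc (0:ℝ) 1,
      f (a * b / (l * a + (1 - l) * b)) ≤ (1 - l) * f a + l * f b)
    (u v : ℝ) (hu : u ∈ I) (hv : v ∈ I) (huv : u < v)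
    (hint : IntervalIntegrable f MeasureTheory.volume u v) :
    f (2 * u * v / (u + v)) ≤ (u * v / (v - u)) * ∫ x in u..v, f x / x ^ 2 ∧
      (u * v / (v - u)) * ∫ x in u..v, f x / x ^ 2 ≤ (f u + f v) / 2 := by
  have hu₀ : 0 < u := hI hu
  have hv₀ : 0 < v := hI hv
  have h_conv : ConvexOn ℝ (Set.Icc v⁻¹ u⁻¹) fun t ↦ f t⁻¹ := by
    refine ⟨convex_Icc _ _, fun s hs t ht a b ha hb hab ↦ ?_⟩
    rw [← inv_image_Icc_of_pos hu₀ huv.le] at hs ht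
    obtain ⟨x, hx, rfl⟩ := hs
    obtain ⟨y, hy, rfl⟩ := ht
    have hx₀ : 0 < x := hu₀.trans_le hx.1
    have hy₀ : 0 < y := hu₀.trans_le hy.1
    have h := hf x (hIcc.out hu hv hx) y (hIcc.out hu hv hy) b ⟨hb, by linarith⟩
    rw [show 1 - b = a by linarith] at h
    have h_arg : (a * x⁻¹ + b * y⁻¹)⁻¹ = x * y / (b * x + a * y) := by
      rw [show a * x⁻¹ + b * y⁻¹ = (b * x + a * y) / (x * y) by field_simp; ring, inv_div]
    simpa only [smul_eq_mul, inv_inv, h_arg] using h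
  obtain ⟨h_int, h_eq⟩ := intervalIntegral_comp_inv hu₀ huv.le hint
  have h := h_conv.hermite_hadamard (inv_strictAnti₀ hu₀ huv) h_int
  have h_sub : 0 < v - u := sub_pos.2 huv
  have h_mid : ((v⁻¹ + u⁻¹) / 2)⁻¹ = 2 * u * v / (u + v) := by field_simp
  have h_len : (u⁻¹ - v⁻¹)⁻¹ = u * v / (v - u) := by
    rw [inv_sub_inv hu₀.ne' hv₀.ne', inv_div]
  simpa only [h_eq, h_mid, h_len, inv_inv, add_comm (f v)] using h
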